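/- Let φ : C_κ → ℝ be convex and monotone with φ(0) = 0 and continuous from above (φ(f_n) ↓ φ(f) whenever (f_n) ⊂ C_κ decreases pointwise to f ∈ C_κ). Define φ₁ : U_κ → [-∞,∞) by φ₁(f) := inf{ φ(g) : g ∈ C_κ, g ≥ f }. Then φ₁ is convex, monotone, extends φ, is continuous from above on U_κ (φ₁(f_n) ↓ φ₁(f) whenever (f_n) ⊂ U_κ decreases pointwise to f ∈ U_κ), is the unique extension of φ to U_κ with these continuity properties, and for every r ≥ 0 and every f ∈ U_κ with ‖f‖_κ ≤ r one has φ₁(f) = max_{μ ∈ M_r} ( ∫_X f dμ − φ*(μ) ), where M_r := {μ ∈ ca_κ⁺ : φ*(μ) ≤ φ(2r/κ) − 2φ(−r/κ)}. -/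

import Mathlib

open Filter MeasureTheory Topology
open scoped ENNReal Topology

noncomputable section

def ecoe {X : Type*} (f : X → ℝ) : X → EReal := fun x => (f x : EReal)

variable {X : Type*} [MetricSpace X]

/-- membership in `C_κ` -/
def MemCk (κ : X → ℝ) (f : X → ℝ) : Prop :=
  Continuous f ∧ ∃ r : ℝ, ∀ x, |f x| * κ x ≤ r

/-- `‖f‖_κ ≤ r` -/
def CkBound (κ : X → ℝ) (r : ℝ) (f : X → ℝ) : Prop := ∀ x, |f x| * κ x ≤ r

/-- extended `κ`-norm of an `EReal`-valued function -/
def eknorm (κ : X → ℝ) (f : X → EReal) : ℝ≥0∞ :=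
  ⨆ x, (f x).abs * ENNReal.ofReal (κ x)

/-- positive part of an `EReal`-valued function -/
def epos {X : Type*} (f : X → EReal) : X → EReal := fun x => max (f x) 0

/-- membership in `U_κ` -/
def MemUk (κ : X → ℝ) (f : X → EReal) : Prop :=
  UpperSemicontinuous f ∧ (∀ x, f x < ⊤) ∧
    ∃ r : ℝ, ∀ x, max (f x) 0 * (κ x : EReal) ≤ (r : EReal)

/-- `Γ`-limsup of a sequence of functions -/
def gammaLimsup (f : ℕ → X → EReal) (x : X) : EReal :=
  ⨆ (u : ℕ → X) (_ : Tendsto u atTop (𝓝 x)),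
    Filter.limsup (fun n => f n (u n)) atTop

/-- `g = Γ-lim f_n` -/
def IsGammaLim (f : ℕ → X → EReal) (g : X → EReal) : Prop :=
  ∀ x : X,
    (∀ u : ℕ → X, Tendsto u atTop (𝓝 x) →
      Filter.limsup (fun n => f n (u n)) atTop ≤ g x) ∧
    (∃ u : ℕ → X, Tendsto u atTop (𝓝 x) ∧
      Tendsto (fun n => f n (u n)) atTop (𝓝 (g x)))

/-- `Γ`-limsup as `h ↓ 0` -/
def gammaLimsupZero (F : ℝ → X → EReal) (x : X) : EReal :=
  ⨆ (h : ℕ → ℝ) (_ : ∀ n, 0 < h n) (_ : Tendsto h atTop (𝓝 (0:ℝ))),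
    gammaLimsup (fun n => F (h n)) x

/-- `Γ`-limsup as `s → t`, `s ≥ 0` -/
def gammaLimsupAt (F : ℝ → X → EReal) (t : ℝ) (x : X) : EReal :=
  ⨆ (s : ℕ → ℝ) (_ : ∀ n, 0 ≤ s n) (_ : Tendsto s atTop (𝓝 t)),
    gammaLimsup (fun n => F (s n)) x

/-- Assumption S on a family of operators on `U_κ` -/
structure AssumptionS (κ : X → ℝ) (S : ℝ → (X → EReal) → (X → EReal)) : Prop where
  monotone : ∀ t, 0 ≤ t → ∀ f g, MemUk κ f → MemUk κ g →
    (∀ x, f x ≤ g x) → ∀ x, S t f x ≤ S t g x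
  convex : ∀ t, 0 ≤ t → ∀ f g, MemUk κ f → MemUk κ g → ∀ lam : ℝ, 0 ≤ lam → lam ≤ 1 →
    ∀ x, S t (fun y => (lam : EReal) * f y + ((1 - lam : ℝ) : EReal) * g y) x
      ≤ (lam : EReal) * S t f x + ((1 - lam : ℝ) : EReal) * S t g x
  zero : ∀ t, 0 ≤ t → ∀ x, S t (fun _ => (0 : EReal)) x = 0
  maps : ∀ t, 0 ≤ t → ∀ f, MemUk κ f → MemUk κ (S t f)
  contAbove : ∀ t, 0 ≤ t → ∀ (f : ℕ → X → EReal) (g : X → EReal),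
    (∀ n, MemUk κ (f n)) → MemUk κ g →
    (∀ x, Antitone fun n => f n x) → (∀ x, (⨅ n, f n x) = g x) →
    ∀ x, (⨅ n, S t (f n) x) = S t g x
  gammaUsc : ∀ t, 0 ≤ t → ∀ f, MemUk κ f →
    ∀ x, gammaLimsupAt (fun s => S s f) t x ≤ S t f x
  idZero : ∀ f, MemUk κ f → S 0 f = f
  bounded : ∀ r t : ℝ, 0 ≤ r → 0 ≤ t → ∃ C : ℝ≥0∞, C ≠ ⊤ ∧
    ∀ s, 0 ≤ s → s ≤ t → ∀ f : X → ℝ, MemCk κ f → CkBound κ r f →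
      eknorm κ (S s (ecoe f)) ≤ C

/-- an `EReal`-valued function which belongs to `C_κ` -/
def IsCk (κ : X → ℝ) (F : X → EReal) : Prop :=
  ∃ g : X → ℝ, MemCk κ g ∧ ∀ x, F x = (g x : EReal)

/-- the upper Lipschitz set `L^S_+` -/
def UpperLip (κ : X → ℝ) (S : ℝ → (X → EReal) → (X → EReal)) (f : X → ℝ) : Prop :=
  MemCk κ f ∧
  (∀ t, 0 ≤ t → IsCk κ (S t (ecoe f))) ∧
  (∀ s t, 0 ≤ s → 0 ≤ t → S (s + t) (ecoe f) = S s (S t (ecoe f))) ∧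
  ∃ h₀ > (0:ℝ), ∃ c ≥ (0:ℝ), ∀ h, 0 ≤ h → h ≤ h₀ → ∀ x,
    max (S h (ecoe f) x - (f x : EReal)) 0 * (κ x : EReal) ≤ ((c * h : ℝ) : EReal)

/-- the (two-sided) Lipschitz set `L^S` -/
def LipSet (κ : X → ℝ) (S : ℝ → (X → EReal) → (X → EReal)) (f : X → ℝ) : Prop :=
  MemCk κ f ∧
  (∀ t, 0 ≤ t → IsCk κ (S t (ecoe f))) ∧
  (∀ s t, 0 ≤ s → 0 ≤ t → S (s + t) (ecoe f) = S s (S t (ecoe f))) ∧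
  ∃ h₀ > (0:ℝ), ∃ c ≥ (0:ℝ), ∀ h, 0 ≤ h → h ≤ h₀ → ∀ x,
    (S h (ecoe f) x - (f x : EReal)).abs * ENNReal.ofReal (κ x) ≤ ENNReal.ofReal (c * h)

/-- difference quotient `(S(h)f - f)/h` -/
def diffQuot (S : ℝ → (X → EReal) → (X → EReal)) (f : X → ℝ) (h : ℝ) : X → EReal :=
  fun x => ((h⁻¹ : ℝ) : EReal) * (S h (ecoe f) x - (f x : EReal))

/-- the upper `Γ`-generator `A_Γ⁺` -/
def uppGen (S : ℝ → (X → EReal) → (X → EReal)) (f : X → ℝ) : X → EReal :=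
  fun x => gammaLimsupZero (fun h => diffQuot S f h) x

/-- `g = A_Γ f`, i.e. the `Γ`-limit of the difference quotients exists and equals `g` -/
def IsGammaDeriv (S : ℝ → (X → EReal) → (X → EReal)) (f : X → ℝ) (g : X → EReal) : Prop :=
  ∀ h : ℕ → ℝ, (∀ n, 0 < h n) → Tendsto h atTop (𝓝 (0:ℝ)) →
    IsGammaLim (fun n => diffQuot S f (h n)) g

/-- `g = Af` in the mixed topology -/
def MixedDeriv (κ : X → ℝ) (S : ℝ → (X → EReal) → (X → EReal)) (f : X → ℝ) (g : X → ℝ) : Prop :=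
  (∃ h₀ > (0:ℝ), ∃ r : ℝ, ∀ h, 0 < h → h ≤ h₀ → ∀ x,
      |h⁻¹ * ((S h (ecoe f) x).toReal - f x)| * κ x ≤ r) ∧
  ∀ K : Set X, IsCompact K → ∀ ε > (0:ℝ), ∃ h₀ > (0:ℝ), ∀ h, 0 < h → h ≤ h₀ → ∀ x ∈ K,
    |h⁻¹ * ((S h (ecoe f) x).toReal - f x) - g x| ≤ ε

/-- upper `ε`-parallel function -/
def parallel (κ : X → ℝ) (f : X → EReal) (ε : ℝ) : X → EReal :=
  fun x => (((κ x)⁻¹ : ℝ) : EReal) *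
    ((⨆ y ∈ Metric.closedBall x ε, max (f y * (κ y : EReal)) (((-ε⁻¹ : ℝ)) : EReal)) + (ε : EReal))

/-- upper semicontinuous envelope of the upper `ε`-parallel function -/
def parallelEnv (κ : X → ℝ) (f : X → EReal) (ε : ℝ) : X → EReal :=
  fun x => ⨅ (δ : ℝ) (_ : 0 < δ), ⨆ y ∈ Metric.closedBall x δ, parallel κ f ε y

end

noncomputable section

/-- truncation of an extended real to `ℝ≥0∞` -/
def erealToENNReal (x : EReal) : ℝ≥0∞ := if x = ⊤ then ⊤ else ENNReal.ofReal x.toReal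

/-- Lebesgue integral of an `EReal`-valued function on `(a,b]`, with values in `[-∞,∞]` -/
def eIntegral (a b : ℝ) (F : ℝ → EReal) : EReal :=
  ((∫⁻ s in Set.Ioc a b, erealToENNReal (max (F s) 0)) : ℝ≥0∞) -
  ((∫⁻ s in Set.Ioc a b, erealToENNReal (max (-F s) 0)) : ℝ≥0∞)

/-- convolution `f * μ` of an `EReal`-valued function with a measure -/
def econv {X : Type*} [NormedAddCommGroup X] [MeasurableSpace X]
    (μ : Measure X) (f : X → EReal) (x : X) : EReal :=
  ((∫⁻ y, erealToENNReal (max (f (x - y)) 0) ∂μ : ℝ≥0∞) : EReal) -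
  ((∫⁻ y, erealToENNReal (max (-f (x - y)) 0) ∂μ : ℝ≥0∞) : EReal)

/-- conjugate functional `φ*` -/
def dualConj {X : Type*} [MetricSpace X] [MeasurableSpace X]
    (κ : X → ℝ) (φ : (X → ℝ) → ℝ) (μ : Measure X) : EReal :=
  ⨆ f : {g : X → ℝ // MemCk κ g}, (((∫ x, f.1 x ∂μ) : ℝ) : EReal) - ((φ f.1 : ℝ) : EReal)

/-- the topology `σ(ca_κ⁺, C_κ)` on measures -/
def weakTopo {X : Type*} [MetricSpace X] [MeasurableSpace X] (κ : X → ℝ) :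
    TopologicalSpace (Measure X) :=
  TopologicalSpace.induced
    (fun μ => fun f : {g : X → ℝ // MemCk κ g} => ∫ x, f.1 x ∂μ) Pi.topologicalSpace

/-- `φ₁`, the extension of `φ` from `C_κ` to `U_κ` -/
def extUk {X : Type*} [MetricSpace X] (κ : X → ℝ) (φ : (X → ℝ) → ℝ) (f : X → EReal) : EReal :=
  ⨅ g : {g : X → ℝ // MemCk κ g ∧ ∀ x, f x ≤ (g x : EReal)}, ((φ g.1 : ℝ) : EReal)

end

section helpers
open BoundedContinuousFunction

structure Adm {X : Type*} [TopologicalSpace X] (U : Set X) (h : X →ᵇ ℝ) : Prop where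
  nonneg : ∀ x, 0 ≤ h x
  le_one : ∀ x, h x ≤ 1
  zero : ∀ x, x ∉ U → h x = 0

theorem adm_zero {X : Type*} [TopologicalSpace X] (U : Set X) : Adm U (0 : X →ᵇ ℝ) :=
  ⟨by simp, by simp, by simp⟩

noncomputable def openVal {X : Type*} [TopologicalSpace X] (L : (X →ᵇ ℝ) →ₗ[ℝ] ℝ) (U : Set X) : ℝ≥0∞ :=
  ⨆ h : {h : X →ᵇ ℝ // Adm U h}, ENNReal.ofReal (L h.1)

theorem le_openVal {X : Type*} [TopologicalSpace X] (L : (X →ᵇ ℝ) →ₗ[ℝ] ℝ) {U : Set X}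
    {h : X →ᵇ ℝ} (hh : Adm U h) : ENNReal.ofReal (L h) ≤ openVal L U :=
  le_iSup (fun h : {h : X →ᵇ ℝ // Adm U h} => ENNReal.ofReal (L h.1)) ⟨h, hh⟩

theorem openVal_mono {X : Type*} [TopologicalSpace X] (L : (X →ᵇ ℝ) →ₗ[ℝ] ℝ) {U V : Set X}
    (h : U ⊆ V) : openVal L U ≤ openVal L V :=
  iSup_le fun g => le_openVal L ⟨g.2.1, g.2.2, fun x hx => g.2.3 x (fun h' => hx (h h'))⟩

theorem openVal_empty {X : Type*} [TopologicalSpace X] (L : (X →ᵇ ℝ) →ₗ[ℝ] ℝ) :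
    openVal L (∅ : Set X) = 0 := by
  refine le_antisymm (iSup_le fun g => ?_) bot_le
  have : g.1 = 0 := by ext x; exact g.2.3 x (by simp)
  simp [this]

theorem exists_cutoff {X : Type*} [MetricSpace X] (U : Set X) (hU : IsOpen U) :
    ∃ p : X → ℝ, Continuous p ∧ (∀ x, 0 ≤ p x) ∧ (∀ x, x ∉ U → p x = 0) ∧ ∀ x ∈ U, 0 < p x := by
  rcases (Uᶜ).eq_empty_or_nonempty with h | h
  · refine ⟨fun _ => 1, continuous_const, by simp, ?_, by simp⟩
    intro x hx
    have : x ∈ Uᶜ := hx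
    simp [h] at this
  · refine ⟨fun x => Metric.infDist x Uᶜ, Metric.continuous_infDist_pt _, fun x => Metric.infDist_nonneg, ?_, ?_⟩
    · intro x hx; exact Metric.infDist_zero_of_mem hx
    · intro x hx
      exact (hU.isClosed_compl.notMem_iff_infDist_pos h).1 (by simpa using hx)

/-- min(1, n p) as a bounded continuous function -/
noncomputable def cutBCF {X : Type*} [TopologicalSpace X] (p : X → ℝ) (hp : Continuous p) (hp0 : ∀ x, 0 ≤ p x) (n : ℕ) :
    X →ᵇ ℝ :=
  BoundedContinuousFunction.ofNormedAddCommGroup (fun x => min 1 (n * p x)) (by fun_prop) 1 (by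
    intro x
    have : 0 ≤ n * p x := mul_nonneg n.cast_nonneg (hp0 x)
    rw [Real.norm_eq_abs, abs_of_nonneg (le_min zero_le_one this)]
    exact min_le_left _ _)

theorem L_mono {X : Type*} [TopologicalSpace X] (L : (X →ᵇ ℝ) →ₗ[ℝ] ℝ)
    (hpos : ∀ h : X →ᵇ ℝ, (∀ x, 0 ≤ h x) → 0 ≤ L h) {f g : X →ᵇ ℝ} (h : ∀ x, f x ≤ g x) : L f ≤ L g := by
  have := hpos (g - f) (fun x => by simpa using h x)
  rw [map_sub] at this
  linarith

theorem openVal_iUnion {X : Type*} [MetricSpace X] (L : (X →ᵇ ℝ) →ₗ[ℝ] ℝ)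
    (hpos : ∀ h : X →ᵇ ℝ, (∀ x, 0 ≤ h x) → 0 ≤ L h)
    (hσ : ∀ hn : ℕ → (X →ᵇ ℝ), (∀ x, Antitone fun n => hn n x) →
      (∀ x, Tendsto (fun n => hn n x) atTop (𝓝 0)) → Tendsto (fun n => L (hn n)) atTop (𝓝 0))
    (U : ℕ → Set X) (hU : ∀ i, IsOpen (U i)) :
    openVal L (⋃ i, U i) ≤ ∑' i, openVal L (U i) := by
  refine iSup_le ?_
  rintro ⟨h, hh⟩
  choose p pc p0 pz pp using fun i => exists_cutoff (U i) (hU i)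
  set S : ℕ → (X →ᵇ ℝ) := fun n => ∑ i ∈ Finset.range n, cutBCF (p i) (pc i) (p0 i) n with hS
  have Sx : ∀ n x, S n x = ∑ i ∈ Finset.range n, min 1 (n * p i x) := by
    intro n x; simp [hS, cutBCF]
  have tn : ∀ (n i : ℕ) x, 0 ≤ min 1 (n * p i x) := fun n i x =>
    le_min zero_le_one (mul_nonneg n.cast_nonneg (p0 i x))
  have Smono : ∀ x, Monotone fun n => S n x := by
    intro x a b hab
    simp only [Sx]
    calc _ ≤ ∑ i ∈ Finset.range a, min 1 ((b:ℝ) * p i x) := by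
          apply Finset.sum_le_sum
          intro i _
          have := p0 i x
          gcongr
      _ ≤ _ := by
          apply Finset.sum_le_sum_of_subset_of_nonneg
          · simpa using hab
          · intro i _ _; exact tn _ _ _
  have key := hσ (fun n => h - h ⊓ S n) (by
      intro x a b hab
      have := Smono x hab
      simp only [BoundedContinuousFunction.coe_sub, BoundedContinuousFunction.coe_inf, Pi.sub_apply, Pi.inf_apply]
      have : h x ⊓ S a x ≤ h x ⊓ S b x := inf_le_inf_left _ this
      linarith) (by
      intro x
      refine tendsto_const_nhds.congr' ?_
      by_cases hx : x ∈ ⋃ i, U i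
      · obtain ⟨i, hi⟩ := Set.mem_iUnion.1 hx
        obtain ⟨N, hN⟩ := exists_nat_gt (1 / p i x)
        filter_upwards [eventually_gt_atTop i, eventually_ge_atTop N] with n hn hn'
        have hpi := pp i x hi
        have h1 : (1:ℝ) ≤ n * p i x := by
          rw [div_lt_iff₀ hpi] at hN
          have : (N:ℝ) ≤ n := by exact_mod_cast hn'
          nlinarith
        have h2 : 1 ≤ S n x := by
          rw [Sx]
          have := Finset.single_le_sum (f := fun i => min 1 ((n:ℝ) * p i x)) (fun j _ => tn n j x) (Finset.mem_range.2 hn)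
          simp only [min_eq_left h1] at this
          exact this
        have h3 := hh.le_one x
        simp [inf_eq_left.2 (h3.trans h2)]
      · refine Eventually.of_forall fun n => ?_
        have : 0 ≤ S n x := by rw [Sx]; exact Finset.sum_nonneg fun i _ => tn n i x
        simp [hh.zero x hx, this])
  have key2 : Tendsto (fun n => ENNReal.ofReal (L (h - h ⊓ S n)) + ∑' i, openVal L (U i)) atTop
      (𝓝 (ENNReal.ofReal 0 + ∑' i, openVal L (U i))) :=
    (ENNReal.tendsto_ofReal key).add tendsto_const_nhds
  rw [ENNReal.ofReal_zero, zero_add] at key2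
  refine ge_of_tendsto' key2 fun n => ?_
  have h1 : L h = L (h - h ⊓ S n) + L (h ⊓ S n) := by rw [← map_add]; simp
  have h2 : L (h ⊓ S n) ≤ L (S n) := L_mono L hpos (fun x => by simp)
  calc ENNReal.ofReal (L h) ≤ ENNReal.ofReal (L (h - h ⊓ S n) + L (S n)) :=
        ENNReal.ofReal_le_ofReal (by linarith)
    _ ≤ ENNReal.ofReal (L (h - h ⊓ S n)) + ENNReal.ofReal (L (S n)) := ENNReal.ofReal_add_le
    _ ≤ _ := by
      gcongr
      simp only [hS, map_sum]
      have adm : ∀ i, Adm (U i) (cutBCF (p i) (pc i) (p0 i) n) := fun i =>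
        ⟨fun x => tn n i x, fun x => min_le_left _ _, fun x hx => by simp [cutBCF, pz i x hx]⟩
      rw [ENNReal.ofReal_sum_of_nonneg (fun i _ => hpos _ (adm i).nonneg)]
      exact (Finset.sum_le_sum fun i _ => le_openVal L (adm i)).trans (ENNReal.sum_le_tsum _)

theorem daniell {X : Type*} [MetricSpace X] [MeasurableSpace X] [BorelSpace X] (L : (X →ᵇ ℝ) →ₗ[ℝ] ℝ)
    (hpos : ∀ h : X →ᵇ ℝ, (∀ x, 0 ≤ h x) → 0 ≤ L h)
    (hσ : ∀ hn : ℕ → (X →ᵇ ℝ), (∀ x, Antitone fun n => hn n x) →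
      (∀ x, Tendsto (fun n => hn n x) atTop (𝓝 0)) → Tendsto (fun n => L (hn n)) atTop (𝓝 0)) :
    ∃ ν : Measure X, IsFiniteMeasure ν ∧ ∀ h : X →ᵇ ℝ, ∫ x, h x ∂ν = L h := by
  let μ : OuterMeasure X := inducedOuterMeasure (P := IsOpen) (fun U _ => openVal L U) isOpen_empty (openVal_empty L)
  have μo : ∀ U, IsOpen U → μ U = openVal L U := fun U hU =>
    inducedOuterMeasure_eq' (P := IsOpen) (m := fun U _ => openVal L U) (P0 := isOpen_empty) (m0 := openVal_empty L)
      (fun f hf => isOpen_iUnion hf) (fun f hf => openVal_iUnion L hpos hσ f hf)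
      (fun s t _ _ h => openVal_mono L h) hU
  have μi : ∀ s, μ s = ⨅ (t : Set X) (ht : IsOpen t) (_ : s ⊆ t), openVal L t := fun s =>
    inducedOuterMeasure_eq_iInf (P := IsOpen) (m := fun U _ => openVal L U) (P0 := isOpen_empty) (m0 := openVal_empty L)
      (fun f hf => isOpen_iUnion hf) (fun f hf => openVal_iUnion L hpos hσ f hf)
      (fun s t _ _ h => openVal_mono L h) s
  have hm : μ.IsMetric := by
    intro s t hst
    refine le_antisymm (measure_union_le s t) ?_
    obtain ⟨r, hr, H⟩ := hst
    rw [μi (s ∪ t)]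
    refine le_iInf fun U => le_iInf fun hU => le_iInf fun hsub => ?_
    let A : Set X := {x | Metric.infEDist x s < Metric.infEDist x t}
    let B : Set X := {x | Metric.infEDist x t < Metric.infEDist x s}
    have hA : IsOpen A := isOpen_lt Metric.continuous_infEDist Metric.continuous_infEDist
    have hB : IsOpen B := isOpen_lt Metric.continuous_infEDist Metric.continuous_infEDist
    have sA : s ⊆ U ∩ A := by
      intro x hx
      refine ⟨hsub (Or.inl hx), ?_⟩
      show Metric.infEDist x s < Metric.infEDist x t
      rw [Metric.infEDist_zero_of_mem hx]
      exact (pos_iff_ne_zero.2 hr).trans_le (Metric.le_infEDist.2 fun y hy => H x hx y hy)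
    have tB : t ⊆ U ∩ B := by
      intro x hx
      refine ⟨hsub (Or.inr hx), ?_⟩
      show Metric.infEDist x t < Metric.infEDist x s
      rw [Metric.infEDist_zero_of_mem hx]
      exact (pos_iff_ne_zero.2 hr).trans_le (Metric.le_infEDist.2 fun y hy => by
        rw [edist_comm]; exact H y hy x hx)
    calc μ s + μ t ≤ μ (U ∩ A) + μ (U ∩ B) := add_le_add (measure_mono sA) (measure_mono tB)
      _ = openVal L (U ∩ A) + openVal L (U ∩ B) := by rw [μo _ (hU.inter hA), μo _ (hU.inter hB)]
      _ ≤ openVal L U := by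
        have : ∀ V : Set X, Nonempty {h : X →ᵇ ℝ // Adm V h} := fun V => ⟨⟨0, adm_zero V⟩⟩
        refine ENNReal.iSup_add_iSup_le fun f g => ?_
        rw [← ENNReal.ofReal_add (hpos _ f.2.nonneg) (hpos _ g.2.nonneg), ← map_add]
        apply le_openVal
        refine ⟨fun x => add_nonneg (f.2.nonneg x) (g.2.nonneg x), fun x => ?_, fun x hx => ?_⟩
        · show f.1 x + g.1 x ≤ 1
          by_cases hx : x ∈ A
          · have : x ∉ U ∩ B := fun h => lt_asymm (show Metric.infEDist x s < Metric.infEDist x t from hx) (show Metric.infEDist x t < Metric.infEDist x s from h.2)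
            rw [g.2.zero x this, add_zero]; exact f.2.le_one x
          · rw [f.2.zero x (fun h => hx h.2), zero_add]; exact g.2.le_one x
        · show f.1 x + g.1 x = 0
          rw [f.2.zero x (fun h => hx h.1), g.2.zero x (fun h => hx h.1), add_zero]
  let ν : Measure X := μ.toMeasure hm.le_caratheodory
  have νo : ∀ U, IsOpen U → ν U = openVal L U := fun U hU => by
    rw [← μo U hU]; exact toMeasure_apply _ _ hU.measurableSet
  have νuniv : ν Set.univ = ENNReal.ofReal (L 1) := by
    rw [νo _ isOpen_univ]
    refine le_antisymm (iSup_le fun g => ENNReal.ofReal_le_ofReal (L_mono L hpos fun x => by simpa using g.2.le_one x)) ?_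
    exact le_openVal L ⟨by simp, by simp, by simp⟩
  have fin : IsFiniteMeasure ν := ⟨by rw [νuniv]; exact ENNReal.ofReal_lt_top⟩
  have νr : ν.real Set.univ = L 1 := by
    rw [Measure.real, νuniv, ENNReal.toReal_ofReal (hpos _ (by simp))]
  have P : ∀ ε : ℝ, 0 < ε → ∀ (n : ℕ) (h : X →ᵇ ℝ), (∀ x, 0 ≤ h x) → (∀ x, h x ≤ n * ε) →
      L h ≤ ∫ x, h x ∂ν + ε * ν.real {x | 0 < h x} := by
    intro ε hε n
    induction n with
    | zero =>
      intro h h0 h1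
      have : h = 0 := by ext x; exact le_antisymm (by simpa using h1 x) (h0 x)
      simp [this]
    | succ n ih =>
      intro h h0 h1
      let c : X →ᵇ ℝ := BoundedContinuousFunction.const X ε
      have e : h = (h ⊓ c) + (h - h ⊓ c) := by simp
      have hn : ∀ x, 0 ≤ (h - h ⊓ c) x := fun x => by simp
      have i1 := ih (h - h ⊓ c) hn (by
        intro x
        have := h1 x
        push_cast at this
        simp only [BoundedContinuousFunction.coe_sub, BoundedContinuousFunction.coe_inf, Pi.sub_apply, Pi.inf_apply, c, BoundedContinuousFunction.const_apply]
        have h3 : 0 ≤ n * ε := by positivity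
        rcases le_total (h x) ε with h2 | h2
        · rw [inf_eq_left.2 h2]; linarith
        · rw [inf_eq_right.2 h2]; linarith)
      have hset : {x | 0 < (h - h ⊓ c) x} = {x | ε < h x} := by
        ext x
        simp [c]
      rw [hset] at i1
      have i2 : L (h ⊓ c) ≤ ε * ν.real {x | 0 < h x} := by
        have ho : IsOpen {x | 0 < h x} := isOpen_lt continuous_const h.continuous
        have adm : Adm {x | 0 < h x} (ε⁻¹ • (h ⊓ c)) := by
          refine ⟨fun x => ?_, fun x => ?_, fun x hx => ?_⟩
          · have : 0 ≤ h x ⊓ ε := le_inf (h0 x) hε.le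
            simpa [c] using mul_nonneg (inv_nonneg.2 hε.le) this
          · have : h x ⊓ ε ≤ ε := inf_le_right
            have := mul_le_mul_of_nonneg_left this (inv_nonneg.2 hε.le)
            rw [inv_mul_cancel₀ hε.ne'] at this
            simpa [c] using this
          · have : h x = 0 := le_antisymm (not_lt.1 hx) (h0 x)
            simp [c, this, hε.le]
        have := le_openVal L adm
        rw [← νo _ ho] at this
        have := ENNReal.toReal_mono (measure_ne_top _ _) this
        rw [ENNReal.toReal_ofReal (hpos _ adm.nonneg), map_smul, smul_eq_mul] at this
        rw [inv_mul_le_iff₀ hε] at this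
        exact this
      have i3 : ε * ν.real {x | ε < h x} ≤ ∫ x, (h ⊓ c) x ∂ν := by
        have hms : MeasurableSet {x | ε < h x} := (isOpen_lt continuous_const h.continuous).measurableSet
        have : ε * ν.real {x | ε < h x} = ∫ x, Set.indicator {x | ε < h x} (fun _ => ε) x ∂ν := by
          rw [integral_indicator hms]; simp [mul_comm]
        rw [this]
        refine integral_mono ((integrable_const ε).indicator hms) ((h ⊓ c).integrable ν) fun x => ?_
        by_cases hx : ε < h x
        · simp [Set.indicator, hx, c, hx.le]
        · simp [Set.indicator, hx, c, hε.le, h0 x]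
      have i4 : ∫ x, h x ∂ν = ∫ x, (h ⊓ c) x ∂ν + ∫ x, (h - h ⊓ c) x ∂ν := by
        rw [← integral_add ((h ⊓ c).integrable ν) ((h - h ⊓ c).integrable ν)]
        congr 1; ext x; simp
      have i5 : L h = L (h ⊓ c) + L (h - h ⊓ c) := by rw [← map_add]; simp
      linarith
  have Q : ∀ h : X →ᵇ ℝ, (∀ x, 0 ≤ h x) → L h ≤ ∫ x, h x ∂ν := by
    intro h h0
    have T : Tendsto (fun ε : ℝ => ∫ x, h x ∂ν + ε * ν.real {x | 0 < h x}) (𝓝[>] 0)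
        (𝓝 (∫ x, h x ∂ν + 0 * ν.real {x | 0 < h x})) := by
      apply Tendsto.mono_left _ nhdsWithin_le_nhds
      apply Continuous.tendsto
      fun_prop
    rw [zero_mul, add_zero] at T
    refine ge_of_tendsto T ?_
    filter_upwards [self_mem_nhdsWithin] with ε hε
    have hε : 0 < ε := hε
    obtain ⟨n, hn⟩ := exists_nat_gt (‖h‖ / ε)
    refine P ε hε n h h0 fun x => ?_
    rw [div_lt_iff₀ hε] at hn
    exact ((le_abs_self _).trans (h.norm_coe_le_norm x)).trans hn.le
  have R : ∀ h : X →ᵇ ℝ, L h ≤ ∫ x, h x ∂ν := by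
    intro h
    have := Q (h + ‖h‖ • 1) (fun x => by
      have := (neg_abs_le _).trans' (neg_le_neg (h.norm_coe_le_norm x))
      simp; linarith)
    rw [map_add, map_smul] at this
    have e : ∫ x, (h + ‖h‖ • (1 : X →ᵇ ℝ)) x ∂ν = ∫ x, h x ∂ν + ‖h‖ * L 1 := by
      simp only [BoundedContinuousFunction.coe_add, Pi.add_apply, BoundedContinuousFunction.coe_smul, BoundedContinuousFunction.coe_one, Pi.one_apply]
      rw [integral_add (h.integrable ν) (integrable_const _)]
      simp [νr, mul_comm]
    rw [e, smul_eq_mul] at this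
    linarith
  refine ⟨ν, fin, fun h => le_antisymm ?_ (R h)⟩
  have := R (-h)
  rw [map_neg] at this
  simp only [BoundedContinuousFunction.coe_neg, Pi.neg_apply, integral_neg] at this
  linarith

theorem subgrad_exists {E : Type*} [AddCommGroup E] [Module ℝ E] (Ψ : E → ℝ)
    (hc : ∀ x y (t : ℝ), 0 ≤ t → t ≤ 1 → Ψ (t • x + (1 - t) • y) ≤ t * Ψ x + (1 - t) * Ψ y) :
    ∃ l : E →ₗ[ℝ] ℝ, ∀ h, l h ≤ Ψ h - Ψ 0 := by
  let q : E → {t : ℝ // 0 < t} → ℝ := fun h t => (Ψ (t.1 • h) - Ψ 0) / t.1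
  have : Nonempty {t : ℝ // 0 < t} := ⟨⟨1, one_pos⟩⟩
  have bdd : ∀ h, BddBelow (Set.range (q h)) := by
    intro h
    refine ⟨Ψ 0 - Ψ (-h), ?_⟩
    rintro _ ⟨⟨t, ht⟩, rfl⟩
    show _ ≤ (Ψ (t • h) - Ψ 0) / t
    have h1 : 0 < 1 + t := by linarith
    have := hc (-h) (t • h) (t / (1 + t)) (by positivity) ((div_le_one h1).2 (by linarith))
    have e : (t / (1 + t)) • -h + (1 - t / (1 + t)) • t • h = 0 := by
      rw [smul_neg, smul_smul, ← sub_eq_neg_add, ← sub_smul]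
      have : (1 - t / (1 + t)) * t - t / (1 + t) = 0 := by field_simp; ring
      rw [this, zero_smul]
    rw [e] at this
    rw [le_div_iff₀ ht]
    have e2 : t / (1 + t) * Ψ (-h) + (1 - t / (1 + t)) * Ψ (t • h) = (t * Ψ (-h) + Ψ (t • h)) / (1 + t) := by
      field_simp; ring
    rw [e2, le_div_iff₀ h1] at this
    linarith
  let N : E → ℝ := fun h => ⨅ t, q h t
  have Nle : ∀ h (t : ℝ) (ht : 0 < t), N h ≤ (Ψ (t • h) - Ψ 0) / t := fun h t ht =>
    ciInf_le (bdd h) ⟨t, ht⟩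
  have hom1 : ∀ c : ℝ, 0 < c → ∀ x, N (c • x) ≤ c * N x := by
    intro c hc x
    rw [← div_le_iff₀' hc]
    refine le_ciInf fun t => ?_
    rw [div_le_iff₀' hc]
    have := Nle (c • x) (t.1 / c) (div_pos t.2 hc)
    rw [smul_smul, div_mul_cancel₀ _ hc.ne'] at this
    refine this.trans (le_of_eq ?_)
    show _ = c * ((Ψ (t.1 • x) - Ψ 0) / t.1)
    have := t.2.ne'
    field_simp
  have hom : ∀ c : ℝ, 0 < c → ∀ x, N (c • x) = c * N x := by
    intro c hc x
    refine le_antisymm (hom1 c hc x) ?_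
    have := hom1 c⁻¹ (inv_pos.2 hc) (c • x)
    rw [smul_smul, inv_mul_cancel₀ hc.ne', one_smul] at this
    rwa [le_inv_mul_iff₀ hc] at this
  have add : ∀ x y, N (x + y) ≤ N x + N y := by
    intro x y
    refine le_ciInf_add_ciInf fun s t => ?_
    obtain ⟨s, hs⟩ := s
    obtain ⟨t, ht⟩ := t
    show _ ≤ (Ψ (s • x) - Ψ 0) / s + (Ψ (t • y) - Ψ 0) / t
    have hst : 0 < s + t := add_pos hs ht
    have h1 := Nle (x + y) (s * t / (s + t)) (by positivity)
    have h2 := hc (s • x) (t • y) (t / (s + t)) (by positivity) ((div_le_one hst).2 (by linarith))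
    have e : (t / (s + t)) • s • x + (1 - t / (s + t)) • t • y = (s * t / (s + t)) • (x + y) := by
      rw [smul_smul, smul_smul, smul_add]
      congr 2
      · ring
      · field_simp; ring
    rw [e] at h2
    refine h1.trans ?_
    rw [div_le_iff₀ (by positivity)]
    have e3 : ((Ψ (s • x) - Ψ 0) / s + (Ψ (t • y) - Ψ 0) / t) * (s * t / (s + t)) =
      t / (s + t) * Ψ (s • x) + (1 - t / (s + t)) * Ψ (t • y) - Ψ 0 := by
      field_simp; ring
    rw [e3]; linarith
  obtain ⟨g, -, hg⟩ := exists_extension_of_le_sublinear (⊥ : E →ₗ.[ℝ] ℝ) N hom add (by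
    rintro ⟨x, hx⟩
    have hx' : x = 0 := (Submodule.mem_bot ℝ).1 hx
    subst hx'
    have h0 : N 0 = 0 := by
      have := hom 2 two_pos 0
      rw [smul_zero] at this; linarith
    have : (⊥ : E →ₗ.[ℝ] ℝ) ⟨0, hx⟩ = 0 := LinearPMap.map_zero _
    simp only [h0]; exact this.le)
  refine ⟨g, fun h => (hg h).trans ?_⟩
  have := Nle h 1 one_pos
  simpa using this

section approx
variable {X : Type*} [MetricSpace X]

theorem memUk_bound {κ : X → ℝ} (hκpos : ∀ x, 0 < κ x) {f : X → EReal} (hf : MemUk κ f) :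
    ∃ R : ℝ, 0 ≤ R ∧ ∀ x, f x ≤ ((R / κ x : ℝ) : EReal) := by
  obtain ⟨-, ht, r, hr⟩ := hf
  refine ⟨max r 0, le_max_right _ _, fun x => ?_⟩
  have h := hr x
  have hm : max (f x) 0 = (((max (f x) 0).toReal : ℝ) : EReal) := by
    rw [EReal.coe_toReal]
    · exact (max_lt (ht x) (by simp)).ne
    · exact ((bot_lt_iff_ne_bot.2 (by simp)).trans_le (le_max_right (f x) 0)).ne'
  refine (le_max_left (f x) 0).trans ?_
  rw [hm] at h ⊢
  rw [← EReal.coe_mul, EReal.coe_le_coe_iff] at h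
  rw [EReal.coe_le_coe_iff, le_div_iff₀ (hκpos x)]
  exact h.trans (le_max_left _ _)

theorem memCk_div {κ : X → ℝ} (hκc : Continuous κ) (hκpos : ∀ x, 0 < κ x) {g : X → ℝ}
    (hg : Continuous g) {R : ℝ} (hR : ∀ x, |g x| ≤ R) : MemCk κ (fun x => g x / κ x) := by
  refine ⟨hg.div hκc fun x => (hκpos x).ne', R, fun x => ?_⟩
  rw [abs_div, abs_of_pos (hκpos x), div_mul_cancel₀ _ (hκpos x).ne']
  exact hR x

theorem memCk_const {κ : X → ℝ} (hκc : Continuous κ) (hκpos : ∀ x, 0 < κ x) (R : ℝ) :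
    MemCk κ (fun x => R / κ x) :=
  memCk_div hκc hκpos (g := fun _ => R) continuous_const (R := |R|) fun _ => le_rfl

theorem memCk_max {κ : X → ℝ} (hκpos : ∀ x, 0 < κ x) {f g : X → ℝ} (hf : MemCk κ f) (hg : MemCk κ g) :
    MemCk κ (fun x => max (f x) (g x)) := by
  obtain ⟨fc, r, hr⟩ := hf
  obtain ⟨gc, s, hs⟩ := hg
  refine ⟨fc.max gc, max r s, fun x => ?_⟩
  have := hκpos x
  show |max (f x) (g x)| * κ x ≤ _
  rcases max_choice (f x) (g x) with h | h <;> rw [h]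
  · exact (hr x).trans (le_max_left _ _)
  · exact (hs x).trans (le_max_right _ _)

theorem memCk_min {κ : X → ℝ} (hκpos : ∀ x, 0 < κ x) {f g : X → ℝ} (hf : MemCk κ f) (hg : MemCk κ g) :
    MemCk κ (f ⊓ g) := by
  obtain ⟨fc, r, hr⟩ := hf
  obtain ⟨gc, s, hs⟩ := hg
  refine ⟨fc.min gc, max r s, fun x => ?_⟩
  have := hκpos x
  rcases min_choice (f x) (g x) with h | h <;> simp only [Pi.inf_apply] <;> rw [h]
  · exact (hr x).trans (le_max_left _ _)
  · exact (hs x).trans (le_max_right _ _)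

theorem approx_exists {κ : X → ℝ} (hκc : Continuous κ) (hκpos : ∀ x, 0 < κ x) {f : X → EReal}
    (hf : MemUk κ f) : ∃ g : ℕ → X → ℝ, (∀ n, MemCk κ (g n)) ∧ (∀ x, Antitone fun n => g n x) ∧
      ∀ x, (⨅ n, (g n x : EReal)) = f x := by
  obtain ⟨R, hR0, hR⟩ := memUk_bound hκpos hf
  obtain ⟨usc, ht, -⟩ := hf
  let v : ℕ → X → EReal := fun n y => max (f y) ((-n / κ y : ℝ) : EReal)
  have hv : ∀ n y, v n y = (((v n y).toReal : ℝ) : EReal) := fun n y => by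
    rw [EReal.coe_toReal]
    · exact (max_lt (ht y) (EReal.coe_lt_top _)).ne
    · exact ((EReal.bot_lt_coe _).trans_le (le_max_right _ _)).ne'
  let u : ℕ → X → ℝ := fun n y => (v n y).toReal * κ y
  have uR : ∀ n y, u n y ≤ R := fun n y => by
    have : v n y ≤ ((R / κ y : ℝ) : EReal) := by
      refine max_le (hR y) (EReal.coe_le_coe_iff.2 ?_)
      have := hκpos y
      gcongr
      have : (0:ℝ) ≤ n := n.cast_nonneg
      linarith
    rw [hv, EReal.coe_le_coe_iff, le_div_iff₀ (hκpos y)] at this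
    exact this
  have un : ∀ (n : ℕ) y, -(n:ℝ) ≤ u n y := fun n y => by
    have : ((-n / κ y : ℝ) : EReal) ≤ v n y := le_max_right _ _
    rw [hv, EReal.coe_le_coe_iff, div_le_iff₀ (hκpos y)] at this
    exact this
  have uf : ∀ n y, f y ≤ ((u n y / κ y : ℝ) : EReal) := fun n y => by
    have e : u n y / κ y = (v n y).toReal := mul_div_cancel_right₀ _ (hκpos y).ne'
    rw [e, ← hv]; exact le_max_left _ _
  have uanti : ∀ m n, m ≤ n → ∀ y, u n y ≤ u m y := fun m n hmn y => by
    have h1 : v n y ≤ v m y := by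
      refine max_le_max le_rfl (EReal.coe_le_coe_iff.2 ?_)
      have := hκpos y
      have : (m:ℝ) ≤ n := by exact_mod_cast hmn
      gcongr
    rw [hv, hv m, EReal.coe_le_coe_iff] at h1
    exact mul_le_mul_of_nonneg_right h1 (hκpos y).le
  have ule : ∀ (n : ℕ) y (c : ℝ), f y ≤ ((c / κ y : ℝ) : EReal) → -(n:ℝ) ≤ c → u n y ≤ c := by
    intro n y c h1 h2
    have : v n y ≤ ((c / κ y : ℝ) : EReal) := by
      refine max_le h1 (EReal.coe_le_coe_iff.2 ?_)
      have := hκpos y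
      gcongr
    rw [hv, EReal.coe_le_coe_iff, le_div_iff₀ (hκpos y)] at this
    exact this
  let G : ℕ → X → ℝ := fun n x => ⨆ y, (u n y - n * dist x y)
  have hd : ∀ (n : ℕ) (x y : X), 0 ≤ n * dist x y := fun n x y => by positivity
  have bdd : ∀ n x, BddAbove (Set.range fun y => u n y - n * dist x y) := by
    intro n x
    refine ⟨R, ?_⟩
    rintro _ ⟨y, rfl⟩
    have := uR n y
    have := hd n x y
    show u n y - n * dist x y ≤ R
    linarith
  have leG : ∀ n x y, u n y - n * dist x y ≤ G n x := fun n x y => le_ciSup (bdd n x) y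
  have uG : ∀ n x, u n x ≤ G n x := fun n x => by simpa using leG n x x
  have GR : ∀ n x, G n x ≤ R := fun n x => by
    have : Nonempty X := ⟨x⟩
    refine ciSup_le fun y => ?_
    have := uR n y
    have := hd n x y
    linarith
  have Gc : ∀ n, Continuous (G n) := by
    intro n
    refine (LipschitzWith.of_le_add_mul (n : NNReal) (f := G n) fun x x' => ?_).continuous
    have : Nonempty X := ⟨x⟩
    refine ciSup_le fun y => ?_
    have h1 := leG n x' y
    have h2 : dist x' y ≤ dist x x' + dist x y := by rw [dist_comm x x']; exact dist_triangle _ _ _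
    have h3 : (n:ℝ) * dist x' y ≤ n * (dist x x' + dist x y) := by gcongr
    simp only [NNReal.coe_natCast]
    linarith
  refine ⟨fun n x => G n x / κ x, fun n => ?_, fun x m n hmn => ?_, fun x => ?_⟩
  · refine memCk_div hκc hκpos (Gc n) (R := max n R) fun x => ?_
    refine abs_le.2 ⟨?_, (GR n x).trans (le_max_right _ _)⟩
    have := (un n x).trans (uG n x)
    have := le_max_left (n:ℝ) R
    linarith
  · show G n x / κ x ≤ G m x / κ x
    have := hκpos x
    gcongr
    have : Nonempty X := ⟨x⟩
    refine ciSup_le fun y => ?_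
    have h1 := leG m x y
    have h2 := uanti m n hmn y
    have h3 : (m:ℝ) ≤ n := by exact_mod_cast hmn
    have h4 : (m:ℝ) * dist x y ≤ n * dist x y := by gcongr
    linarith
  · refine le_antisymm ?_ (le_iInf fun n => (uf n x).trans ?_)
    · refine EReal.le_of_forall_lt_iff_le.1 fun q hq => ?_
      obtain ⟨q1, h1, h2⟩ := EReal.lt_iff_exists_real_btwn.1 hq
      rw [EReal.coe_lt_coe_iff] at h2
      have ev : ∀ᶠ y in 𝓝 x, f y < q1 ∧ q1 * κ y < q * κ x := by
        refine (usc x _ h1).and ?_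
        have : Continuous fun y => q1 * κ y := by fun_prop
        exact this.continuousAt.eventually (gt_mem_nhds (mul_lt_mul_of_pos_right h2 (hκpos x)))
      obtain ⟨δ, hδ, H⟩ := Metric.eventually_nhds_iff.1 ev
      obtain ⟨n, hn⟩ := exists_nat_gt (max (-(q * κ x)) ((R - q * κ x) / δ))
      refine (iInf_le _ n).trans (EReal.coe_le_coe_iff.2 ?_)
      rw [div_le_iff₀ (hκpos x)]
      have : Nonempty X := ⟨x⟩
      refine ciSup_le fun y => ?_
      by_cases hy : dist y x < δ
      · obtain ⟨a, b⟩ := H hy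
        have := ule n y (q * κ x) (a.le.trans (EReal.coe_le_coe_iff.2 ((le_div_iff₀ (hκpos y)).2 b.le)))
          (by have := (le_max_left _ _).trans_lt hn; linarith)
        have := hd n x y
        linarith
      · have h3 := (le_max_right _ _).trans_lt hn
        rw [div_lt_iff₀ hδ] at h3
        have h4 : (n:ℝ) * δ ≤ n * dist x y := by
          rw [dist_comm]; gcongr; exact not_lt.1 hy
        have := uR n y
        linarith
    · refine EReal.coe_le_coe_iff.2 ?_
      have := hκpos x
      exact div_le_div_of_nonneg_right (uG n x) this.le

end approx

section main
variable {X : Type*} [MetricSpace X]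

theorem le_extUk {κ : X → ℝ} {φ : (X → ℝ) → ℝ} {f : X → EReal} {c : EReal}
    (h : ∀ g, MemCk κ g → (∀ x, f x ≤ (g x : EReal)) → c ≤ ((φ g : ℝ) : EReal)) : c ≤ extUk κ φ f :=
  le_iInf fun g => h g.1 g.2.1 g.2.2

theorem extUk_le {κ : X → ℝ} {φ : (X → ℝ) → ℝ} {f : X → EReal} {g : X → ℝ}
    (hg : MemCk κ g) (h : ∀ x, f x ≤ (g x : EReal)) : extUk κ φ f ≤ ((φ g : ℝ) : EReal) :=
  iInf_le (fun g : {g : X → ℝ // MemCk κ g ∧ ∀ x, f x ≤ (g x : EReal)} => ((φ g.1 : ℝ) : EReal)) ⟨g, hg, h⟩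

theorem extUk_mono {κ : X → ℝ} {φ : (X → ℝ) → ℝ} {f g : X → EReal} (h : ∀ x, f x ≤ g x) :
    extUk κ φ f ≤ extUk κ φ g :=
  le_extUk fun k hk hgk => extUk_le hk fun x => (h x).trans (hgk x)

theorem extUk_ecoe {κ : X → ℝ} {φ : (X → ℝ) → ℝ}
    (hmono : ∀ f g, MemCk κ f → MemCk κ g → (∀ x, f x ≤ g x) → φ f ≤ φ g) {f : X → ℝ} (hf : MemCk κ f) :
    extUk κ φ (ecoe f) = ((φ f : ℝ) : EReal) :=
  le_antisymm (extUk_le hf fun _ => le_rfl) (le_extUk fun g hg h => EReal.coe_le_coe_iff.2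
    (hmono f g hf hg fun x => EReal.coe_le_coe_iff.1 (h x)))

theorem memCk_comb {κ : X → ℝ} (hκpos : ∀ x, 0 < κ x) {f g : X → ℝ} (hf : MemCk κ f) (hg : MemCk κ g)
    (a b : ℝ) : MemCk κ (fun y => a * f y + b * g y) := by
  obtain ⟨fc, r, hr⟩ := hf
  obtain ⟨gc, s, hs⟩ := hg
  refine ⟨by fun_prop, |a| * r + |b| * s, fun x => ?_⟩
  calc |a * f x + b * g x| * κ x ≤ (|a * f x| + |b * g x|) * κ x :=
        mul_le_mul_of_nonneg_right (abs_add_le _ _) (hκpos x).le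
    _ = |a| * (|f x| * κ x) + |b| * (|g x| * κ x) := by rw [abs_mul, abs_mul]; ring
    _ ≤ _ := add_le_add (mul_le_mul_of_nonneg_left (hr x) (abs_nonneg _))
      (mul_le_mul_of_nonneg_left (hs x) (abs_nonneg _))

theorem extUk_lt_top {κ : X → ℝ} (hκc : Continuous κ) (hκpos : ∀ x, 0 < κ x) {φ : (X → ℝ) → ℝ}
    {f : X → EReal} (hf : MemUk κ f) : extUk κ φ f < ⊤ := by
  obtain ⟨R, -, hR⟩ := memUk_bound hκpos hf
  exact (extUk_le (memCk_const hκc hκpos R) hR).trans_lt (EReal.coe_lt_top _)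

theorem extUk_convex {κ : X → ℝ} (hκpos : ∀ x, 0 < κ x) {φ : (X → ℝ) → ℝ}
    (hconv : ∀ f g, MemCk κ f → MemCk κ g → ∀ lam : ℝ, 0 ≤ lam → lam ≤ 1 →
        φ (fun y => lam * f y + (1 - lam) * g y) ≤ lam * φ f + (1 - lam) * φ g)
    {f g : X → EReal} (hf : extUk κ φ f < ⊤) (hg : extUk κ φ g < ⊤) (lam : ℝ) (h0 : 0 ≤ lam) (h1 : lam ≤ 1) :
      extUk κ φ (fun y => (lam : EReal) * f y + ((1 - lam : ℝ) : EReal) * g y)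
        ≤ (lam : EReal) * extUk κ φ f + ((1 - lam : ℝ) : EReal) * extUk κ φ g := by
  rcases h0.eq_or_lt with rfl | h0
  · simp
  rcases h1.eq_or_lt with rfl | h1
  · simp
  have h1' : 0 < 1 - lam := by linarith
  have key : ∀ (a b : EReal), extUk κ φ f < a → extUk κ φ g < b →
      extUk κ φ (fun y => (lam : EReal) * f y + ((1 - lam : ℝ) : EReal) * g y)
        ≤ (lam : EReal) * a + ((1 - lam : ℝ) : EReal) * b := by
    intro a b ha hb
    obtain ⟨⟨f', hf', hff⟩, hfa⟩ := iInf_lt_iff.1 ha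
    obtain ⟨⟨g', hg', hgg⟩, hgb⟩ := iInf_lt_iff.1 hb
    have e1 : (0 : EReal) ≤ (lam : EReal) := by exact_mod_cast h0.le
    have e2 : (0 : EReal) ≤ ((1 - lam : ℝ) : EReal) := by exact_mod_cast h1'.le
    refine (extUk_le (memCk_comb hκpos hf' hg' lam (1 - lam)) fun x => ?_).trans ?_
    · push_cast [EReal.coe_add, EReal.coe_mul]
      exact add_le_add (mul_le_mul_of_nonneg_left (hff x) e1) (mul_le_mul_of_nonneg_left (hgg x) (by simpa using e2))
    · refine (EReal.coe_le_coe_iff.2 (hconv f' g' hf' hg' lam h0.le h1.le)).trans ?_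
      rw [EReal.coe_add, EReal.coe_mul, EReal.coe_mul]
      exact add_le_add (mul_le_mul_of_nonneg_left hfa.le e1) (mul_le_mul_of_nonneg_left hgb.le e2)
  have pt : ∀ (c : ℝ), 0 < c → ∀ a : EReal, a < ⊤ → (c : EReal) * a < ⊤ := by
    intro c hc a ha
    induction a with
    | bot => rw [EReal.coe_mul_bot_of_pos hc]; exact bot_lt_top
    | coe a => rw [← EReal.coe_mul]; exact EReal.coe_lt_top _
    | top => exact absurd ha (lt_irrefl _)
  have inv : ∀ (c : ℝ), 0 < c → ∀ a b : EReal, (c : EReal) * a < b → ∃ a', a < a' ∧ (c : EReal) * a' ≤ b := by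
    intro c hc a b h
    refine ⟨b / c, ?_, ?_⟩
    · rw [EReal.lt_div_iff (by exact_mod_cast hc) (EReal.coe_ne_top _)]
      rwa [mul_comm]
    · rw [EReal.mul_div_cancel (EReal.coe_ne_bot _) (EReal.coe_ne_top _) (by exact_mod_cast hc.ne')]
  refine EReal.le_add_of_forall_gt (Or.inr (pt _ h1' _ hg).ne) (Or.inl (pt _ h0 _ hf).ne) fun a ha b hb => ?_
  obtain ⟨a', ha', ha⟩ := inv _ h0 _ _ ha
  obtain ⟨b', hb', hb⟩ := inv _ h1' _ _ hb
  exact (key a' b' ha' hb').trans (add_le_add ha hb)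

theorem iInf_phi_eq {κ : X → ℝ} (hκpos : ∀ x, 0 < κ x) {φ : (X → ℝ) → ℝ}
    (hmono : ∀ f g, MemCk κ f → MemCk κ g → (∀ x, f x ≤ g x) → φ f ≤ φ g)
    (hca : ∀ (fn : ℕ → X → ℝ) (f : X → ℝ), (∀ n, MemCk κ (fn n)) → MemCk κ f →
      (∀ x, Antitone fun n => fn n x) → (∀ x, Tendsto (fun n => fn n x) atTop (𝓝 (f x))) →
      Tendsto (fun n => φ (fn n)) atTop (𝓝 (φ f)))
    {g : ℕ → X → ℝ} {f : X → EReal} (hg : ∀ n, MemCk κ (g n)) (ha : ∀ x, Antitone fun n => g n x)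
    (hi : ∀ x, (⨅ n, (g n x : EReal)) = f x) : (⨅ n, ((φ (g n) : ℝ) : EReal)) = extUk κ φ f := by
  refine le_antisymm (le_extUk fun k hk hfk => ?_)
    (le_iInf fun n => extUk_le (hg n) fun x => (hi x) ▸ iInf_le _ n)
  have T := hca (fun n x => max (g n x) (k x)) k (fun n => memCk_max hκpos (hg n) hk) hk
    (fun x m n hmn => max_le_max (ha x hmn) le_rfl) (by
      intro x
      have h1 : Tendsto (fun n => ((g n x : ℝ) : EReal)) atTop (𝓝 (f x)) := by
        rw [← hi x]
        exact tendsto_atTop_iInf fun m n hmn => EReal.coe_le_coe_iff.2 (ha x hmn)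
      have h2 := h1.max (tendsto_const_nhds (x := ((k x : ℝ) : EReal)))
      rw [max_eq_right (hfk x)] at h2
      rw [← EReal.tendsto_coe]
      refine h2.congr fun n => ?_
      exact (EReal.coe_strictMono.monotone.map_max).symm)
  refine ge_of_tendsto' (EReal.tendsto_coe.2 T) fun n => ?_
  refine (iInf_le _ n).trans (EReal.coe_le_coe_iff.2 ?_)
  exact hmono _ _ (hg n) (memCk_max hκpos (hg n) hk) fun x => le_max_left _ _

theorem extUk_contAbove {κ : X → ℝ} (hκc : Continuous κ) (hκpos : ∀ x, 0 < κ x) {φ : (X → ℝ) → ℝ}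
    (hmono : ∀ f g, MemCk κ f → MemCk κ g → (∀ x, f x ≤ g x) → φ f ≤ φ g)
    (hca : ∀ (fn : ℕ → X → ℝ) (f : X → ℝ), (∀ n, MemCk κ (fn n)) → MemCk κ f →
      (∀ x, Antitone fun n => fn n x) → (∀ x, Tendsto (fun n => fn n x) atTop (𝓝 (f x))) →
      Tendsto (fun n => φ (fn n)) atTop (𝓝 (φ f)))
    (fn : ℕ → X → EReal) (f : X → EReal) (hfn : ∀ n, MemUk κ (fn n))
    (ha : ∀ x, Antitone fun n => fn n x) (hi : ∀ x, (⨅ n, fn n x) = f x) :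
    (⨅ n, extUk κ φ (fn n)) = extUk κ φ f := by
  choose G Gk Ga Gi using fun n => approx_exists hκc hκpos (hfn n)
  have hne : ∀ k : ℕ, (Finset.range (k + 1)).Nonempty := fun k => Finset.nonempty_range_add_one
  let g : ℕ → X → ℝ := fun k => (Finset.range (k + 1)).inf' (hne k) fun n => G n k
  have gx : ∀ k x, g k x = (Finset.range (k + 1)).inf' (hne k) fun n => G n k x := fun k x =>
    Finset.inf'_apply _ _ _
  have gle : ∀ n k x, n ≤ k → g k x ≤ G n k x := fun n k x h => by
    rw [gx]; exact Finset.inf'_le (f := fun n => G n k x) (Finset.mem_range.2 (by omega))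
  have fG : ∀ n k x, fn n x ≤ (G n k x : EReal) := fun n k x => (Gi n x) ▸ iInf_le _ k
  have fg : ∀ k x, fn k x ≤ (g k x : EReal) := fun k x => by
    obtain ⟨n, hn, e⟩ := Finset.exists_mem_eq_inf' (hne k) fun n => G n k x
    rw [gx, e]
    exact (ha x (by rw [Finset.mem_range] at hn; omega)).trans (fG n k x)
  have gk : ∀ k, MemCk κ (g k) := fun k =>
    Finset.inf'_induction (p := MemCk κ) (hne k) _ (fun a ha b hb => memCk_min hκpos ha hb) fun n _ => Gk n k
  have gi : ∀ x, (⨅ k, (g k x : EReal)) = f x := by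
    intro x
    refine le_antisymm ?_ (le_iInf fun k => ((hi x) ▸ iInf_le _ k : f x ≤ fn k x).trans (fg k x))
    rw [← hi x]
    refine le_iInf fun n => ?_
    rw [← Gi n x]
    refine le_iInf fun k => (iInf_le _ (max n k)).trans (EReal.coe_le_coe_iff.2 ?_)
    exact (gle n _ x (le_max_left _ _)).trans (Ga n x (le_max_right _ _))
  refine le_antisymm ?_ (le_iInf fun n => extUk_mono fun x => (hi x) ▸ iInf_le _ n)
  rw [← iInf_phi_eq hκpos hmono hca gk (fun x k l hkl => ?_) gi]
  · exact iInf_mono fun k => extUk_le (gk k) (fg k)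
  · show g l x ≤ g k x
    rw [gx k]
    refine Finset.le_inf' _ _ fun n hn => ?_
    rw [Finset.mem_range] at hn
    exact (gle n l x (by omega)).trans (Ga n x hkl)

theorem memUk_ecoe {κ : X → ℝ} (hκpos : ∀ x, 0 < κ x) {f : X → ℝ} (hf : MemCk κ f) : MemUk κ (ecoe f) := by
  obtain ⟨fc, r, hr⟩ := hf
  refine ⟨(continuous_coe_real_ereal.comp fc).upperSemicontinuous, fun x => EReal.coe_lt_top _, r, fun x => ?_⟩
  have : max (ecoe f x) 0 = ((max (f x) 0 : ℝ) : EReal) := by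
    rw [EReal.coe_strictMono.monotone.map_max]; rfl
  rw [this, ← EReal.coe_mul, EReal.coe_le_coe_iff]
  refine (mul_le_mul_of_nonneg_right ?_ (hκpos x).le).trans (hr x)
  exact max_le (le_abs_self _) (abs_nonneg _)

theorem extUk_unique {κ : X → ℝ} (hκc : Continuous κ) (hκpos : ∀ x, 0 < κ x) {φ : (X → ℝ) → ℝ}
    (hmono : ∀ f g, MemCk κ f → MemCk κ g → (∀ x, f x ≤ g x) → φ f ≤ φ g)
    (hca : ∀ (fn : ℕ → X → ℝ) (f : X → ℝ), (∀ n, MemCk κ (fn n)) → MemCk κ f →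
      (∀ x, Antitone fun n => fn n x) → (∀ x, Tendsto (fun n => fn n x) atTop (𝓝 (f x))) →
      Tendsto (fun n => φ (fn n)) atTop (𝓝 (φ f)))
    (ψ : (X → EReal) → EReal)
    (h1 : ∀ f, MemCk κ f → ψ (ecoe f) = ((φ f : ℝ) : EReal))
    (h2 : ∀ (fn : ℕ → X → EReal) (f : X → EReal), (∀ n, MemUk κ (fn n)) → MemUk κ f →
        (∀ x, Antitone fun n => fn n x) → (∀ x, (⨅ n, fn n x) = f x) →
        Antitone (fun n => ψ (fn n)) ∧ (⨅ n, ψ (fn n)) = ψ f)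
    (f : X → EReal) (hf : MemUk κ f) : ψ f = extUk κ φ f := by
  obtain ⟨g, gk, ga, gi⟩ := approx_exists hκc hκpos hf
  rw [← iInf_phi_eq hκpos hmono hca gk ga gi, ← (h2 (fun n => ecoe (g n)) f (fun n => memUk_ecoe hκpos (gk n)) hf
    (fun x m n hmn => EReal.coe_le_coe_iff.2 (ga x hmn)) gi).2]
  exact iInf_congr fun n => h1 _ (gk n)

variable [MeasurableSpace X] [BorelSpace X]

theorem integrable_inv {κ : X → ℝ} (hκc : Continuous κ) (hκpos : ∀ x, 0 < κ x) {μ : Measure X}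
    (hμ : (∫⁻ x, ENNReal.ofReal (κ x)⁻¹ ∂μ) ≠ ⊤) : Integrable (fun x => (κ x)⁻¹) μ := by
  have hm : Measurable fun x => (κ x)⁻¹ := hκc.measurable.inv
  refine ⟨hm.aestronglyMeasurable, ?_⟩
  rw [hasFiniteIntegral_iff_ofReal (Eventually.of_forall fun x => (inv_pos.2 (hκpos x)).le)]
  exact lt_top_iff_ne_top.2 hμ

theorem integrable_of_bound {κ : X → ℝ} (hκc : Continuous κ) (hκpos : ∀ x, 0 < κ x) {μ : Measure X}
    (hμ : (∫⁻ x, ENNReal.ofReal (κ x)⁻¹ ∂μ) ≠ ⊤) {F : X → ℝ} (hF : Measurable F) {r : ℝ}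
    (hr : ∀ x, |F x| * κ x ≤ r) : Integrable F μ := by
  refine ((integrable_inv hκc hκpos hμ).const_mul r).mono' hF.aestronglyMeasurable
    (Eventually.of_forall fun x => ?_)
  rw [Real.norm_eq_abs, ← div_eq_mul_inv, le_div_iff₀ (hκpos x)]
  exact hr x

theorem le_dualConj {κ : X → ℝ} {φ : (X → ℝ) → ℝ} {μ : Measure X} {g : X → ℝ} (hg : MemCk κ g) :
    ((∫ x, g x ∂μ - φ g : ℝ) : EReal) ≤ dualConj κ φ μ := by
  rw [EReal.coe_sub]
  exact le_iSup (fun f : {g : X → ℝ // MemCk κ g} =>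
    (((∫ x, f.1 x ∂μ) : ℝ) : EReal) - ((φ f.1 : ℝ) : EReal)) ⟨g, hg⟩

theorem dualConj_le {κ : X → ℝ} {φ : (X → ℝ) → ℝ} {μ : Measure X} {c : ℝ}
    (h : ∀ g, MemCk κ g → ∫ x, g x ∂μ - φ g ≤ c) : dualConj κ φ μ ≤ (c : EReal) :=
  iSup_le fun g => by rw [← EReal.coe_sub]; exact EReal.coe_le_coe_iff.2 (h g.1 g.2)

theorem weak_duality {κ : X → ℝ} (hκc : Continuous κ) (hκpos : ∀ x, 0 < κ x) {φ : (X → ℝ) → ℝ}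
    {μ : Measure X} (hμ : (∫⁻ x, ENNReal.ofReal (κ x)⁻¹ ∂μ) ≠ ⊤) {F : X → ℝ} (hF : Measurable F) {r : ℝ}
    (hr : ∀ x, |F x| * κ x ≤ r) {A : ℝ} (hA : dualConj κ φ μ = (A : EReal)) :
    ((∫ x, F x ∂μ - A : ℝ) : EReal) ≤ extUk κ φ (ecoe F) := by
  refine le_extUk fun g hg hFg => EReal.coe_le_coe_iff.2 ?_
  have h1 := le_dualConj (φ := φ) (μ := μ) hg
  rw [hA, EReal.coe_le_coe_iff] at h1
  obtain ⟨s, hs⟩ := hg.2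
  have h2 : ∫ x, F x ∂μ ≤ ∫ x, g x ∂μ := integral_mono (integrable_of_bound hκc hκpos hμ hF hr)
    (integrable_of_bound hκc hκpos hμ hg.1.measurable hs) fun x => EReal.coe_le_coe_iff.1 (hFg x)
  linarith

theorem dualConj_real {κ : X → ℝ} (hκpos : ∀ x, 0 < κ x) {φ : (X → ℝ) → ℝ} {μ : Measure X}
    {c : ℝ} (h : dualConj κ φ μ ≤ (c : EReal)) : ∃ A : ℝ, dualConj κ φ μ = (A : EReal) := by
  have h0 : MemCk κ (fun _ : X => (0 : ℝ)) := ⟨continuous_const, 0, by simp⟩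
  have h1 := le_dualConj (φ := φ) (μ := μ) h0
  refine ⟨(dualConj κ φ μ).toReal, (EReal.coe_toReal ?_ ?_).symm⟩
  · exact (h.trans_lt (EReal.coe_lt_top _)).ne
  · exact ((EReal.bot_lt_coe _).trans_le h1).ne'

end main

section strong
variable {X : Type*} [MetricSpace X]

theorem exists_mulB {κ : X → ℝ} (hκc : Continuous κ) (hκpos : ∀ x, 0 < κ x) {g : X → ℝ}
    (hg : MemCk κ g) : ∃ h : X →ᵇ ℝ, ∀ x, h x = g x * κ x := by
  obtain ⟨gc, r, hr⟩ := hg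
  refine ⟨BoundedContinuousFunction.ofNormedAddCommGroup (fun x => g x * κ x) (by fun_prop) r ?_, fun x => rfl⟩
  intro x
  rw [Real.norm_eq_abs, abs_mul, abs_of_pos (hκpos x)]
  exact hr x

theorem extUk_real {κ : X → ℝ} (hκc : Continuous κ) (hκpos : ∀ x, 0 < κ x) {φ : (X → ℝ) → ℝ}
    (hmono : ∀ f g, MemCk κ f → MemCk κ g → (∀ x, f x ≤ g x) → φ f ≤ φ g)
    {F : X → ℝ} {r : ℝ} (hr : ∀ x, |F x| * κ x ≤ r) :
    extUk κ φ (ecoe F) = (((extUk κ φ (ecoe F)).toReal : ℝ) : EReal) ∧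
      φ (fun x => -r / κ x) ≤ (extUk κ φ (ecoe F)).toReal := by
  have h1 : extUk κ φ (ecoe F) ≤ ((φ (fun x => r / κ x) : ℝ) : EReal) := by
    refine extUk_le (memCk_const hκc hκpos r) fun x => EReal.coe_le_coe_iff.2 ?_
    rw [le_div_iff₀ (hκpos x)]
    exact (mul_le_mul_of_nonneg_right (le_abs_self _) (hκpos x).le).trans (hr x)
  have h2 : ((φ (fun x => -r / κ x) : ℝ) : EReal) ≤ extUk κ φ (ecoe F) := by
    rw [← extUk_ecoe hmono (memCk_const hκc hκpos (-r))]
    refine extUk_mono fun x => EReal.coe_le_coe_iff.2 ?_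
    rw [div_le_iff₀ (hκpos x)]
    have := (mul_le_mul_of_nonneg_right (neg_abs_le (F x)) (hκpos x).le)
    have := hr x
    linarith
  have e : extUk κ φ (ecoe F) = (((extUk κ φ (ecoe F)).toReal : ℝ) : EReal) := by
    rw [EReal.coe_toReal]
    · exact (h1.trans_lt (EReal.coe_lt_top _)).ne
    · exact ((EReal.bot_lt_coe _).trans_le h2).ne'
  refine ⟨e, ?_⟩
  rw [e] at h2
  exact EReal.coe_le_coe_iff.1 h2

theorem strong_duality [MeasurableSpace X] [BorelSpace X]
    {κ : X → ℝ} (hκc : Continuous κ) (hκpos : ∀ x, 0 < κ x) {φ : (X → ℝ) → ℝ}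
    (hmono : ∀ f g, MemCk κ f → MemCk κ g → (∀ x, f x ≤ g x) → φ f ≤ φ g)
    (hconv : ∀ f g, MemCk κ f → MemCk κ g → ∀ lam : ℝ, 0 ≤ lam → lam ≤ 1 →
        φ (fun y => lam * f y + (1 - lam) * g y) ≤ lam * φ f + (1 - lam) * φ g)
    (hzero : φ (fun _ => 0) = 0)
    (hca : ∀ (fn : ℕ → X → ℝ) (f : X → ℝ), (∀ n, MemCk κ (fn n)) → MemCk κ f →
      (∀ x, Antitone fun n => fn n x) → (∀ x, Tendsto (fun n => fn n x) atTop (𝓝 (f x))) →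
      Tendsto (fun n => φ (fn n)) atTop (𝓝 (φ f)))
    {F : X → ℝ} (hF : Measurable F) (hFU : MemUk κ (ecoe F)) {r : ℝ} (hr : ∀ x, |F x| * κ x ≤ r) :
    ∃ μ : Measure X, (∫⁻ x, ENNReal.ofReal (κ x)⁻¹ ∂μ) ≠ ⊤ ∧
        dualConj κ φ μ ≤ ((φ (fun x => 2 * r / κ x) - 2 * φ (fun x => -r / κ x) : ℝ) : EReal) ∧
        extUk κ φ (ecoe F) = ((∫ x, F x ∂μ : ℝ) : EReal) - dualConj κ φ μ := by
  let Fh : (X →ᵇ ℝ) → X → ℝ := fun h x => F x + h x / κ x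
  let Ψ : (X →ᵇ ℝ) → ℝ := fun h => (extUk κ φ (ecoe (Fh h))).toReal
  have hΨ : ∀ h, extUk κ φ (ecoe (Fh h)) = ((Ψ h : ℝ) : EReal) := fun h => by
    refine (extUk_real hκc hκpos hmono (r := r + ‖h‖) fun x => ?_).1
    have h1 : |Fh h x| ≤ |F x| + |h x| / κ x := by
      refine (abs_add_le _ _).trans (le_of_eq ?_)
      rw [abs_div, abs_of_pos (hκpos x)]
    refine (mul_le_mul_of_nonneg_right h1 (hκpos x).le).trans ?_
    rw [add_mul, div_mul_cancel₀ _ (hκpos x).ne']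
    exact add_le_add (hr x) (h.norm_coe_le_norm x)
  have Ψmono : ∀ h k, (∀ x, Fh h x ≤ Fh k x) → Ψ h ≤ Ψ k := fun h k hk => by
    have := extUk_mono (κ := κ) (φ := φ) (f := ecoe (Fh h)) (g := ecoe (Fh k)) fun x => EReal.coe_le_coe_iff.2 (hk x)
    rwa [hΨ, hΨ, EReal.coe_le_coe_iff] at this
  have e0 : Fh 0 = F := by funext x; simp [Fh]
  obtain ⟨l, hl⟩ := subgrad_exists Ψ (by
    intro x y t ht0 ht1
    have := extUk_convex hκpos hconv (f := ecoe (Fh x)) (g := ecoe (Fh y))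
      (by rw [hΨ]; exact EReal.coe_lt_top _) (by rw [hΨ]; exact EReal.coe_lt_top _) t ht0 ht1
    have e : (fun z => (t : EReal) * ecoe (Fh x) z + ((1 - t : ℝ) : EReal) * ecoe (Fh y) z) =
        ecoe (Fh (t • x + (1 - t) • y)) := by
      funext z
      simp only [ecoe]
      rw [← EReal.coe_mul, ← EReal.coe_mul, ← EReal.coe_add, EReal.coe_eq_coe_iff]
      simp only [Fh, BoundedContinuousFunction.coe_add, BoundedContinuousFunction.coe_smul, Pi.add_apply, smul_eq_mul]
      ring
    rw [e, hΨ, hΨ, hΨ, ← EReal.coe_mul, ← EReal.coe_mul, ← EReal.coe_add, EReal.coe_le_coe_iff] at this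
    exact this)
  have hpos : ∀ h : X →ᵇ ℝ, (∀ x, 0 ≤ h x) → 0 ≤ l h := by
    intro h h0
    have h1 := hl (-h)
    have h2 := Ψmono (-h) 0 (fun x => by
      have := div_nonneg (h0 x) (hκpos x).le
      simp [Fh, neg_div, this])
    rw [map_neg] at h1
    linarith
  -- key inequality
  have key : ∀ g k : X → ℝ, MemCk κ g → (∀ x, F x ≤ k x) → ∀ (hg hk : X →ᵇ ℝ), (∀ x, hg x = g x * κ x) →
      (∀ x, hk x = k x * κ x) → l hg - φ g ≤ l hk - Ψ 0 := by
    intro g k gm Fk hg hk eg ek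
    have h1 := hl (hg - hk)
    have h2 : Ψ (hg - hk) ≤ φ g := by
      rw [← EReal.coe_le_coe_iff, ← hΨ]
      refine extUk_le gm fun x => EReal.coe_le_coe_iff.2 ?_
      have := Fk x
      have e : Fh (hg - hk) x = F x + (g x - k x) := by
        simp only [Fh, BoundedContinuousFunction.coe_sub, Pi.sub_apply, eg, ek]
        rw [← sub_mul, mul_div_cancel_right₀ _ (hκpos x).ne']
      rw [e]; linarith
    rw [map_sub] at h1
    linarith
  have Fr : ∀ x, F x ≤ r / κ x := fun x => by
    rw [le_div_iff₀ (hκpos x)]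
    exact (mul_le_mul_of_nonneg_right (le_abs_self _) (hκpos x).le).trans (hr x)
  obtain ⟨hR, eR⟩ := exists_mulB hκc hκpos (memCk_const hκc hκpos r)
  obtain ⟨ν, hν, hνl⟩ := daniell l hpos (by
    intro hn ha h0
    have hn0 : ∀ n x, 0 ≤ hn n x := fun n x => (ha x).le_of_tendsto (h0 x) n
    set C := l hR - Ψ 0 with hC
    have mem : ∀ (s : ℝ) n, MemCk κ (fun x => (s • hn n) x / κ x) := fun s n =>
      memCk_div hκc hκpos (s • hn n).continuous (R := ‖s • hn n‖) fun x => (s • hn n).norm_coe_le_norm x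
    have b : ∀ (s : ℝ) n, s * l (hn n) ≤ φ (fun x => (s • hn n) x / κ x) + C := by
      intro s n
      have := key (fun x => (s • hn n) x / κ x) _ (mem s n) Fr (s • hn n) hR
        (fun x => (div_mul_cancel₀ _ (hκpos x).ne').symm) eR
      rw [map_smul, smul_eq_mul] at this
      linarith
    have lim : ∀ s : ℝ, 0 ≤ s → Tendsto (fun n => φ (fun x => (s • hn n) x / κ x)) atTop (𝓝 0) := by
      intro s hs
      rw [← hzero]
      refine hca _ _ (mem s) ⟨continuous_const, 0, by simp⟩ (fun x m n hmn => ?_) fun x => ?_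
      · exact div_le_div_of_nonneg_right (mul_le_mul_of_nonneg_left (ha x hmn) hs) (hκpos x).le
      · have := ((h0 x).const_mul s).div_const (κ x)
        simpa using this
    rw [Metric.tendsto_atTop]
    intro ε hε
    obtain ⟨s, hs⟩ := exists_nat_gt ((1 + C) / ε)
    have hs' : 1 + C < s * ε := by rwa [div_lt_iff₀ hε] at hs
    have ev := (lim s s.cast_nonneg).eventually (gt_mem_nhds (zero_lt_one))
    obtain ⟨N, hN⟩ := eventually_atTop.1 ev
    refine ⟨N, fun n hn' => ?_⟩
    rw [Real.dist_eq, sub_zero, abs_of_nonneg (hpos _ (hn0 n))]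
    have h1 := b s n
    have h2 := hN n hn'
    have h3 : (s:ℝ) * l (hn n) < s * ε := by linarith
    exact lt_of_mul_lt_mul_left h3 s.cast_nonneg)
  have mκ : Measurable fun x => ENNReal.ofReal (κ x) := hκc.measurable.ennreal_ofReal
  let μ : Measure X := ν.withDensity fun x => ENNReal.ofReal (κ x)
  have hμ : (∫⁻ x, ENNReal.ofReal (κ x)⁻¹ ∂μ) ≠ ⊤ := by
    have mi : Measurable fun x => ENNReal.ofReal (κ x)⁻¹ := hκc.measurable.inv.ennreal_ofReal
    rw [lintegral_withDensity_eq_lintegral_mul ν mκ mi]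
    have : ∀ x, ((fun x => ENNReal.ofReal (κ x)) * fun x => ENNReal.ofReal (κ x)⁻¹) x = 1 := fun x => by
      rw [Pi.mul_apply, ← ENNReal.ofReal_mul (hκpos x).le, mul_inv_cancel₀ (hκpos x).ne', ENNReal.ofReal_one]
    simp only [this, lintegral_one]
    exact measure_ne_top _ _
  have hint : ∀ (g : X → ℝ) (hg : X →ᵇ ℝ), (∀ x, hg x = g x * κ x) → ∫ x, g x ∂μ = l hg := by
    intro g hg e
    rw [← hνl hg, integral_withDensity_eq_integral_toReal_smul mκ (Eventually.of_forall fun x => ENNReal.ofReal_lt_top)]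
    congr 1
    funext x
    rw [ENNReal.toReal_ofReal (hκpos x).le, smul_eq_mul, e, mul_comm]
  have Fint := integrable_of_bound hκc hκpos hμ hF hr
  obtain ⟨k, kk, ka, ki⟩ := approx_exists hκc hκpos hFU
  have Fk : ∀ n x, F x ≤ k n x := fun n x => by
    have : ecoe F x ≤ (k n x : EReal) := (ki x) ▸ iInf_le _ n
    exact EReal.coe_le_coe_iff.1 this
  have klim : Tendsto (fun n => ∫ x, k n x ∂μ) atTop (𝓝 (∫ x, F x ∂μ)) := by
    refine integral_tendsto_of_tendsto_of_antitone (fun n => ?_) Fint (Eventually.of_forall ka)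
      (Eventually.of_forall fun x => ?_)
    · obtain ⟨s, hs⟩ := (kk n).2
      exact integrable_of_bound hκc hκpos hμ (kk n).1.measurable hs
    · rw [← EReal.tendsto_coe]
      have : ((F x : ℝ) : EReal) = ⨅ n, (k n x : EReal) := (ki x).symm
      rw [this]
      exact tendsto_atTop_iInf fun m n hmn => EReal.coe_le_coe_iff.2 (ka x hmn)
  have up : dualConj κ φ μ ≤ ((∫ x, F x ∂μ - Ψ 0 : ℝ) : EReal) := by
    refine dualConj_le fun g hg => ?_
    refine ge_of_tendsto' (klim.sub_const (Ψ 0)) fun n => ?_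
    obtain ⟨hg', eg⟩ := exists_mulB hκc hκpos hg
    obtain ⟨hk', ek⟩ := exists_mulB hκc hκpos (kk n)
    rw [hint g hg' eg, hint (k n) hk' ek]
    exact key g (k n) hg (Fk n) hg' hk' eg ek
  obtain ⟨A, hA⟩ := dualConj_real hκpos up
  have low := weak_duality hκc hκpos hμ hF hr hA
  have hΨ0 := hΨ 0
  rw [e0] at hΨ0
  rw [hΨ0, EReal.coe_le_coe_iff] at low
  rw [hA, EReal.coe_le_coe_iff] at up
  refine ⟨μ, hμ, ?_, ?_⟩
  · rw [hA, EReal.coe_le_coe_iff]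
    have h1 := le_dualConj (φ := φ) (μ := μ) (memCk_const hκc hκpos (2 * r))
    rw [hA, EReal.coe_le_coe_iff] at h1
    have h2 : φ (fun x => -r / κ x) ≤ Ψ 0 := by
      have := (extUk_real hκc hκpos hmono hr).2
      rwa [hΨ0, EReal.toReal_coe] at this
    have h3 : 2 * ∫ x, F x ∂μ ≤ ∫ x, 2 * r / κ x ∂μ := by
      rw [← integral_const_mul]
      refine integral_mono (Fint.const_mul 2) ?_ fun x => ?_
      · simp only [div_eq_mul_inv]
        exact (integrable_inv hκc hκpos hμ).const_mul _
      · show 2 * F x ≤ 2 * r / κ x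
        have := Fr x
        rw [mul_div_assoc]; linarith
    linarith
  · rw [hΨ0, hA, ← EReal.coe_sub, EReal.coe_eq_coe_iff]
    linarith

end strong

end helpers

/-- the extension `φ₁` of `φ` from `C_κ` to `U_κ`. -/
theorem stmt5
    {X : Type*} [MetricSpace X] [CompleteSpace X] [TopologicalSpace.SeparableSpace X]
    [MeasurableSpace X] [BorelSpace X]
    (κ : X → ℝ) (hκc : Continuous κ) (hκpos : ∀ x, 0 < κ x) (hκbd : ∃ C, ∀ x, κ x ≤ C)
    (φ : (X → ℝ) → ℝ)
    (hmono : ∀ f g, MemCk κ f → MemCk κ g → (∀ x, f x ≤ g x) → φ f ≤ φ g)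
    (hconv : ∀ f g, MemCk κ f → MemCk κ g → ∀ lam : ℝ, 0 ≤ lam → lam ≤ 1 →
        φ (fun y => lam * f y + (1 - lam) * g y) ≤ lam * φ f + (1 - lam) * φ g)
    (hzero : φ (fun _ => 0) = 0)
    (hca : ∀ (fn : ℕ → X → ℝ) (f : X → ℝ), (∀ n, MemCk κ (fn n)) → MemCk κ f →
      (∀ x, Antitone fun n => fn n x) → (∀ x, Tendsto (fun n => fn n x) atTop (𝓝 (f x))) →
      Tendsto (fun n => φ (fn n)) atTop (𝓝 (φ f))) :
    -- φ₁ maps U_κ into [-∞,∞)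
    (∀ f, MemUk κ f → extUk κ φ f < ⊤) ∧
    -- φ₁ is monotone
    (∀ f g, MemUk κ f → MemUk κ g → (∀ x, f x ≤ g x) → extUk κ φ f ≤ extUk κ φ g) ∧
    -- φ₁ is convex
    (∀ f g, MemUk κ f → MemUk κ g → ∀ lam : ℝ, 0 ≤ lam → lam ≤ 1 →
      extUk κ φ (fun y => (lam : EReal) * f y + ((1 - lam : ℝ) : EReal) * g y)
        ≤ (lam : EReal) * extUk κ φ f + ((1 - lam : ℝ) : EReal) * extUk κ φ g) ∧
    -- φ₁ extends φ
    (∀ f, MemCk κ f → extUk κ φ (ecoe f) = ((φ f : ℝ) : EReal)) ∧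
    -- φ₁ is continuous from above on U_κ
    (∀ (fn : ℕ → X → EReal) (f : X → EReal), (∀ n, MemUk κ (fn n)) → MemUk κ f →
      (∀ x, Antitone fun n => fn n x) → (∀ x, (⨅ n, fn n x) = f x) →
      Antitone (fun n => extUk κ φ (fn n)) ∧ (⨅ n, extUk κ φ (fn n)) = extUk κ φ f) ∧
    -- uniqueness: φ₁ is the unique extension which is continuous from above
    (∀ ψ : (X → EReal) → EReal,
      (∀ f, MemCk κ f → ψ (ecoe f) = ((φ f : ℝ) : EReal)) →
      (∀ (fn : ℕ → X → EReal) (f : X → EReal), (∀ n, MemUk κ (fn n)) → MemUk κ f →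
        (∀ x, Antitone fun n => fn n x) → (∀ x, (⨅ n, fn n x) = f x) →
        Antitone (fun n => ψ (fn n)) ∧ (⨅ n, ψ (fn n)) = ψ f) →
      ∀ f, MemUk κ f → ψ f = extUk κ φ f) ∧
    -- dual representation
    (∀ r : ℝ, 0 ≤ r → ∀ f : X → EReal, MemUk κ f →
      (∀ x, (f x).abs * ENNReal.ofReal (κ x) ≤ ENNReal.ofReal r) →
      (∀ μ : Measure X, (∫⁻ x, ENNReal.ofReal (κ x)⁻¹ ∂μ) ≠ ⊤ →
        dualConj κ φ μ ≤ ((φ (fun x => 2 * r / κ x) - 2 * φ (fun x => -r / κ x) : ℝ) : EReal) →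
        ((∫ x, (f x).toReal ∂μ : ℝ) : EReal) - dualConj κ φ μ ≤ extUk κ φ f) ∧
      (∃ μ : Measure X, (∫⁻ x, ENNReal.ofReal (κ x)⁻¹ ∂μ) ≠ ⊤ ∧
        dualConj κ φ μ ≤ ((φ (fun x => 2 * r / κ x) - 2 * φ (fun x => -r / κ x) : ℝ) : EReal) ∧
        extUk κ φ f = ((∫ x, (f x).toReal ∂μ : ℝ) : EReal) - dualConj κ φ μ)) := by
  refine ⟨fun f hf => extUk_lt_top hκc hκpos hf, fun f g _ _ h => extUk_mono h,
    fun f g hf hg lam h0 h1 => extUk_convex hκpos hconv (extUk_lt_top hκc hκpos hf)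
      (extUk_lt_top hκc hκpos hg) lam h0 h1,
    fun f hf => extUk_ecoe hmono hf,
    fun fn f hfn _ ha hi => ⟨fun m n hmn => extUk_mono fun x => ha x hmn,
      extUk_contAbove hκc hκpos hmono hca fn f hfn ha hi⟩,
    fun ψ h1 h2 f hf => extUk_unique hκc hκpos hmono hca ψ h1 h2 f hf, ?_⟩
  intro r hr0 f hf hb
  have hnb : ∀ x, f x ≠ ⊥ := by
    intro x hx
    have := hb x
    rw [hx, EReal.abs_bot, ENNReal.top_mul (by simpa using hκpos x)] at this
    exact absurd this (not_le.2 ENNReal.ofReal_lt_top)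
  let F : X → ℝ := fun x => (f x).toReal
  have eF : f = ecoe F := by
    funext x
    exact (EReal.coe_toReal (hf.2.1 x).ne (hnb x)).symm
  have hFm : Measurable F := measurable_ereal_toReal.comp hf.1.measurable
  have hFr : ∀ x, |F x| * κ x ≤ r := by
    intro x
    have := hb x
    rw [eF] at this
    simp only [ecoe] at this
    rw [EReal.abs_def, ← ENNReal.ofReal_mul (abs_nonneg _)] at this
    exact (ENNReal.ofReal_le_ofReal_iff hr0).1 this
  have eI : ∀ μ : Measure X, ∫ x, (f x).toReal ∂μ = ∫ x, F x ∂μ := fun μ => rfl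
  constructor
  · intro μ hμ hd
    obtain ⟨A, hA⟩ := dualConj_real hκpos hd
    rw [eI, hA, ← EReal.coe_sub, eF]
    exact weak_duality hκc hκpos hμ hFm hFr hA
  · obtain ⟨μ, h1, h2, h3⟩ := strong_duality hκc hκpos hmono hconv hzero hca hFm (eF ▸ hf) hFr
    refine ⟨μ, h1, h2, ?_⟩
    rw [eI, ← h3, ← eF]
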